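/- Let n be a finite index type, z ∈ ℝ^n, and let Σ : ℝ × ℝ → Matrix n n ℝ and μ : ℝ × ℝ → ℝ^n be twice continuously differentiable near (t₀,s₀), with Σ(t,s) symmetric for all (t,s) and Σ(t₀,s₀) invertible. Write d = z − μ(t₀,s₀), first partials μ_t, μ_s, Σ_t, Σ_s, mixed second partials μ_{ts}, Σ_{ts}, Σ^{(t)} = −Σ⁻¹Σ_tΣ⁻¹, Σ^{(s)} = −Σ⁻¹Σ_sΣ⁻¹, and let Σ^{(ts)} denote the mixed second partial derivative of (t,s) ↦ Σ(t,s)⁻¹ at (t₀,s₀). Then the mixed second partial derivative at (t₀,s₀) of (t,s) ↦ (z − μ(t,s)) ⬝ᵥ Σ(t,s)⁻¹.mulVec (z − μ(t,s)) equals d ⬝ᵥ Σ^{(ts)}.mulVec d − 2·μ_t ⬝ᵥ Σ^{(s)}.mulVec d − 2·μ_s ⬝ᵥ Σ^{(t)}.mulVec d − 2·μ_{ts} ⬝ᵥ Σ⁻¹.mulVec d + 2·μ_t ⬝ᵥ Σ⁻¹.mulVec μ_s. -/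

import Mathlib

open Matrix

attribute [local instance] Matrix.normedAddCommGroup Matrix.normedSpace

section PartialDerivatives

variable {E : Type*} [NormedAddCommGroup E] [NormedSpace ℝ E] {f : ℝ × ℝ → E} {t₀ s₀ : ℝ}

theorem DifferentiableAt.partial_fst (hf : DifferentiableAt ℝ f (t₀, s₀)) :
    DifferentiableAt ℝ (fun t => f (t, s₀)) t₀ :=
  DifferentiableAt.comp (g := f) t₀ hf (by fun_prop)

theorem DifferentiableAt.hasDerivAt_partial_snd (hf : DifferentiableAt ℝ f (t₀, s₀)) :
    HasDerivAt (fun s => f (t₀, s)) (fderiv ℝ f (t₀, s₀) (0, 1)) s₀ :=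
  HasFDerivAt.comp_hasDerivAt (l := f) s₀ hf.hasFDerivAt
    ((hasDerivAt_const s₀ t₀).prodMk (hasDerivAt_id s₀))

theorem ContDiffAt.eventually_differentiableAt_slice (hf : ContDiffAt ℝ 2 f (t₀, s₀)) :
    ∀ᶠ t in nhds t₀, DifferentiableAt ℝ f (t, s₀) := by
  have h : ∀ᶠ p in nhds (t₀, s₀), DifferentiableAt ℝ f p :=
    (hf.eventually (by simp)).mono fun p hp => hp.differentiableAt (by simp)
  have hc : Filter.Tendsto (fun t : ℝ => (t, s₀)) (nhds t₀) (nhds (t₀, s₀)) :=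
    (Continuous.prodMk_left s₀).tendsto t₀
  exact hc.eventually h

theorem ContDiffAt.differentiableAt_deriv_partial_snd (hf : ContDiffAt ℝ 2 f (t₀, s₀)) :
    DifferentiableAt ℝ (fun t => deriv (fun s => f (t, s)) s₀) t₀ := by
  have h1 : DifferentiableAt ℝ (fderiv ℝ f) (t₀, s₀) :=
    (hf.fderiv_right (m := 1) (by norm_num)).differentiableAt (by simp)
  have h2 : DifferentiableAt ℝ (fun t => fderiv ℝ f (t, s₀) (0, 1)) t₀ :=
    h1.partial_fst.clm_apply (differentiableAt_const _)
  refine h2.congr_of_eventuallyEq ?_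
  filter_upwards [hf.eventually_differentiableAt_slice] with t ht
  exact ht.hasDerivAt_partial_snd.deriv

end PartialDerivatives

section MatrixCalculus

variable {n : Type*} [Fintype n]

theorem HasDerivAt.matrix_apply {A : ℝ → Matrix n n ℝ} {A' : Matrix n n ℝ} {x : ℝ}
    (hA : HasDerivAt A A' x) (i j : n) : HasDerivAt (fun y => A y i j) (A' i j) x :=
  hasDerivAt_pi.1 (hasDerivAt_pi.1 hA i) j

theorem HasDerivAt.matrix_mul {A B : ℝ → Matrix n n ℝ} {A' B' : Matrix n n ℝ} {x : ℝ}
    (hA : HasDerivAt A A' x) (hB : HasDerivAt B B' x) :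
    HasDerivAt (fun y => A y * B y) (A' * B x + A x * B') x := by
  refine hasDerivAt_pi.2 fun i => hasDerivAt_pi.2 fun j => ?_
  simp only [Matrix.add_apply, Matrix.mul_apply, ← Finset.sum_add_distrib]
  exact HasDerivAt.fun_sum fun k _ => (hA.matrix_apply i k).mul (hB.matrix_apply k j)

theorem HasDerivAt.matrix_mulVec {A : ℝ → Matrix n n ℝ} {A' : Matrix n n ℝ} {v : ℝ → n → ℝ}
    {v' : n → ℝ} {x : ℝ} (hA : HasDerivAt A A' x) (hv : HasDerivAt v v' x) :
    HasDerivAt (fun y => A y *ᵥ v y) (A' *ᵥ v x + A x *ᵥ v') x := by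
  refine hasDerivAt_pi.2 fun i => ?_
  simp only [Pi.add_apply, Matrix.mulVec, dotProduct, ← Finset.sum_add_distrib]
  exact HasDerivAt.fun_sum fun k _ => (hA.matrix_apply i k).mul (hasDerivAt_pi.1 hv k)

theorem HasDerivAt.dotProduct {u v : ℝ → n → ℝ} {u' v' : n → ℝ} {x : ℝ}
    (hu : HasDerivAt u u' x) (hv : HasDerivAt v v' x) :
    HasDerivAt (fun y => u y ⬝ᵥ v y) (u' ⬝ᵥ v x + u x ⬝ᵥ v') x := by
  simp only [_root_.dotProduct, ← Finset.sum_add_distrib]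
  exact HasDerivAt.fun_sum fun k _ => (hasDerivAt_pi.1 hu k).mul (hasDerivAt_pi.1 hv k)

variable [DecidableEq n] {E : Type*} [NormedAddCommGroup E] [NormedSpace ℝ E]
  {S : E → Matrix n n ℝ} {p : E} {k : WithTop ℕ∞}

theorem ContDiffAt.matrix_det (hS : ContDiffAt ℝ k S p) :
    ContDiffAt ℝ k (fun q => (S q).det) p := by
  have he : ∀ i j, ContDiffAt ℝ k (fun q => S q i j) p := fun i j =>
    contDiffAt_pi.1 (contDiffAt_pi.1 hS i) j
  simp only [Matrix.det_apply']
  exact ContDiffAt.sum fun σ _ => contDiffAt_const.mul (contDiffAt_prod fun i _ => he _ _)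

theorem ContDiffAt.matrix_inv (hS : ContDiffAt ℝ k S p) (hp : IsUnit (S p).det) :
    ContDiffAt ℝ k (fun q => (S q)⁻¹) p := by
  refine contDiffAt_pi.2 fun i => contDiffAt_pi.2 fun j => ?_
  simp only [Matrix.inv_def, Ring.inverse_eq_inv', Matrix.smul_apply, Matrix.adjugate_apply,
    smul_eq_mul]
  refine (hS.matrix_det.inv hp.ne_zero).mul (ContDiffAt.matrix_det ?_)
  refine contDiffAt_pi.2 fun a => contDiffAt_pi.2 fun b => ?_
  by_cases h : a = j
  · simp only [Matrix.updateRow_apply, h, if_true]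
    exact contDiffAt_const
  · simp only [Matrix.updateRow_apply, h, if_false]
    exact contDiffAt_pi.1 (contDiffAt_pi.1 hS a) b

theorem HasDerivAt.matrix_inv {A : ℝ → Matrix n n ℝ} {A' : Matrix n n ℝ} {x : ℝ}
    (hA : HasDerivAt A A' x) (hx : IsUnit (A x).det)
    (hi : DifferentiableAt ℝ (fun y => (A y)⁻¹) x) :
    HasDerivAt (fun y => (A y)⁻¹) (-((A x)⁻¹ * A' * (A x)⁻¹)) x := by
  have hdet : ∀ᶠ y in nhds x, (A y).det ≠ 0 := by
    have hc : ContinuousAt (fun y => (A y).det) x :=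
      (continuous_id.matrix_det (n := n) (R := ℝ)).continuousAt.comp hA.continuousAt
    exact hc.eventually_ne hx.ne_zero
  have h1 := hi.hasDerivAt.matrix_mul hA
  have h2 : HasDerivAt (fun y => (A y)⁻¹ * A y) 0 x :=
    (hasDerivAt_const x (1 : Matrix n n ℝ)).congr_of_eventuallyEq
      (hdet.mono fun y hy => Matrix.nonsing_inv_mul _ hy.isUnit)
  have h3 := congrArg (· * (A x)⁻¹) (h1.unique h2)
  simp only [add_mul, Matrix.zero_mul, Matrix.mul_nonsing_inv_cancel_right _ _ hx] at h3
  rw [← eq_neg_of_add_eq_zero_left h3]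
  exact hi.hasDerivAt

end MatrixCalculus

theorem Matrix.IsSymm.dotProduct_mulVec_comm {n R : Type*} [Fintype n] [CommSemiring R]
    {A : Matrix n n R} (hA : A.IsSymm) (u v : n → R) : u ⬝ᵥ A *ᵥ v = v ⬝ᵥ A *ᵥ u := by
  rw [Matrix.dotProduct_mulVec, ← Matrix.mulVec_transpose, hA.eq, dotProduct_comm]

/-- Mixed second partial derivative of the Mahalanobis quadratic form
`(t,s) ↦ (z − μ(t,s))ᵀ Σ(t,s)⁻¹ (z − μ(t,s))`, the quantity `m_{(k)j}^{ii'}` of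
Appendix A of the paper. -/
theorem stmt_7 {n : Type*} [Fintype n] [DecidableEq n] (z : n → ℝ)
    (S : ℝ × ℝ → Matrix n n ℝ) (μ : ℝ × ℝ → n → ℝ) (t₀ s₀ : ℝ)
    (hS : ContDiffAt ℝ 2 S (t₀, s₀)) (hμ : ContDiffAt ℝ 2 μ (t₀, s₀))
    (hsym : ∀ ts : ℝ × ℝ, (S ts).IsSymm)
    (hinv : IsUnit (S (t₀, s₀)).det)
    (d : n → ℝ) (hd : d = z - μ (t₀, s₀))
    (μt μs μts : n → ℝ)
    (hμt : μt = deriv (fun t => μ (t, s₀)) t₀)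
    (hμs : μs = deriv (fun s => μ (t₀, s)) s₀)
    (hμts : μts = deriv (fun t => deriv (fun s => μ (t, s)) s₀) t₀)
    (St Ss : Matrix n n ℝ)
    (hSt : St = deriv (fun t => S (t, s₀)) t₀)
    (hSs : Ss = deriv (fun s => S (t₀, s)) s₀)
    (Sinvt Sinvs Sinvts : Matrix n n ℝ)
    (hSinvt : Sinvt = -((S (t₀, s₀))⁻¹ * St * (S (t₀, s₀))⁻¹))
    (hSinvs : Sinvs = -((S (t₀, s₀))⁻¹ * Ss * (S (t₀, s₀))⁻¹))
    (hSinvts : Sinvts = deriv (fun t => deriv (fun s => (S (t, s))⁻¹) s₀) t₀) :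
    deriv (fun t => deriv
        (fun s => (z - μ (t, s)) ⬝ᵥ (S (t, s))⁻¹.mulVec (z - μ (t, s))) s₀) t₀
      = d ⬝ᵥ Sinvts.mulVec d - 2 * (μt ⬝ᵥ Sinvs.mulVec d) - 2 * (μs ⬝ᵥ Sinvt.mulVec d)
        - 2 * (μts ⬝ᵥ (S (t₀, s₀))⁻¹.mulVec d) + 2 * (μt ⬝ᵥ (S (t₀, s₀))⁻¹.mulVec μs) := by
  have hA : ContDiffAt ℝ 2 (fun q => (S q)⁻¹) (t₀, s₀) := hS.matrix_inv hinv
  have hAsymm : ∀ q, ((S q)⁻¹).IsSymm := fun q => by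
    rw [Matrix.IsSymm, Matrix.transpose_nonsing_inv, (hsym q).eq]
  have hAd := hA.differentiableAt (by simp)
  have hSd := hS.differentiableAt (by simp)
  have hμd := hμ.differentiableAt (by simp)
  have hAt : HasDerivAt (fun t => (S (t, s₀))⁻¹) Sinvt t₀ := by
    rw [hSinvt, hSt]
    exact hSd.partial_fst.hasDerivAt.matrix_inv hinv hAd.partial_fst
  have hAs : deriv (fun s => (S (t₀, s))⁻¹) s₀ = Sinvs := by
    rw [hSinvs, hSs]
    exact (hSd.hasDerivAt_partial_snd.differentiableAt.hasDerivAt.matrix_inv hinv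
      hAd.hasDerivAt_partial_snd.differentiableAt).deriv
  have hAts : HasDerivAt (fun t => deriv (fun s => (S (t, s))⁻¹) s₀) Sinvts t₀ := by
    rw [hSinvts]
    exact hA.differentiableAt_deriv_partial_snd.hasDerivAt
  have hvt : HasDerivAt (fun t => z - μ (t, s₀)) (-μt) t₀ := by
    rw [hμt]
    exact hμd.partial_fst.hasDerivAt.const_sub z
  have hvts : HasDerivAt (fun t => deriv (fun s => μ (t, s)) s₀) μts t₀ := by
    rw [hμts]
    exact hμ.differentiableAt_deriv_partial_snd.hasDerivAt
  have hinner : (fun t => deriv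
        (fun s => (z - μ (t, s)) ⬝ᵥ (S (t, s))⁻¹.mulVec (z - μ (t, s))) s₀) =ᶠ[nhds t₀]
      fun t => (z - μ (t, s₀)) ⬝ᵥ (deriv (fun s => (S (t, s))⁻¹) s₀) *ᵥ (z - μ (t, s₀))
        - 2 * (deriv (fun s => μ (t, s)) s₀ ⬝ᵥ (S (t, s₀))⁻¹ *ᵥ (z - μ (t, s₀))) := by
    filter_upwards [hA.eventually_differentiableAt_slice, hμ.eventually_differentiableAt_slice]
      with t hAt' hμt'
    have hv := hμt'.hasDerivAt_partial_snd.differentiableAt.hasDerivAt.const_sub z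
    have ha : HasDerivAt (fun s => (S (t, s))⁻¹) (deriv (fun s => (S (t, s))⁻¹) s₀) s₀ :=
      hAt'.hasDerivAt_partial_snd.differentiableAt.hasDerivAt
    rw [(hv.dotProduct (ha.matrix_mulVec hv)).deriv, dotProduct_add,
      (hAsymm (t, s₀)).dotProduct_mulVec_comm (z - μ (t, s₀))]
    simp only [neg_dotProduct]
    ring
  rw [hinner.deriv_eq, ((hvt.dotProduct (hAts.matrix_mulVec hvt)).fun_sub
    ((hvts.dotProduct (hAt.matrix_mulVec hvt)).const_mul 2)).deriv]
  have hAs_symm : Sinvs.IsSymm := by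
    have hSs_symm : Ss.IsSymm := by
      have h : HasDerivAt (fun s => S (t₀, s)) Ss s₀ := by
        rw [hSs]
        exact hSd.hasDerivAt_partial_snd.differentiableAt.hasDerivAt
      ext i j
      refine (h.matrix_apply j i).unique ?_
      simpa only [(hsym _).apply] using h.matrix_apply i j
    rw [hSinvs, Matrix.IsSymm, Matrix.transpose_neg, Matrix.transpose_mul, Matrix.transpose_mul,
      (hAsymm _).eq, hSs_symm.eq, Matrix.mul_assoc]
  rw [hAs, ← hμs, ← hd, dotProduct_add, dotProduct_add, Matrix.mulVec_neg, Matrix.mulVec_neg,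
    dotProduct_neg, dotProduct_neg, neg_dotProduct, hAs_symm.dotProduct_mulVec_comm d μt,
    (hAsymm _).dotProduct_mulVec_comm μs μt]
  ring
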